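/- arXiv:2102.04443 — 2 statements merged into one kernel-verified Lean document; each statement's English description precedes it below -/
import Mathlib

section
/- Let p be a prime and G a finite group with O_{p'}(G) = 1 that contains an element of order p and in which all non-trivial p-elements are conjugate. Suppose N is a minimal normal subgroup of G that is not abelian. Then N is a non-abelian simple group whose order is divisible by p, C_G(N) = 1 (so G embeds into Aut(N), i.e. G is almost simple with socle N), and p does not divide |G/N|. -/
/-- A `p`-element of a group: an element whose order is a power of `p`. -/
def IsPElement (p : ℕ) {G : Type*} [Group G] (g : G) : Prop :=
  ∃ k : ℕ, orderOf g = p ^ k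

/-- `O_{p'}(G)`: the largest normal subgroup of a (finite) group `G` of order coprime
to `p`. -/
def pPrimeCore (p : ℕ) (G : Type*) [Group G] : Subgroup G :=
  sSup {H : Subgroup G | H.Normal ∧ ¬ p ∣ Nat.card H}

/-- In a finite group, a normal subgroup of order prime to p lies in a characteristic one. -/
theorem exists_char_pprime (p : ℕ) (hp : p.Prime) {N : Type*} [Group N] [Finite N]
    (M : Subgroup N) (hM : M.Normal) (hMp : ¬ p ∣ Nat.card M) :
    ∃ L : Subgroup N, L.Characteristic ∧ M ≤ L ∧ ¬ p ∣ Nat.card L := by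
  obtain ⟨L, hML, hL⟩ := Set.Finite.exists_le_maximal
    (s := {H : Subgroup N | H.Normal ∧ ¬ p ∣ Nat.card H}) (Set.toFinite _) ⟨hM, hMp⟩
  refine ⟨L, ?_, hML, hL.prop.2⟩
  rw [Subgroup.characteristic_iff_map_le]
  intro φ
  haveI := hL.prop.1
  have hn : (L.map φ.toMonoidHom).Normal :=
    Subgroup.Normal.map hL.prop.1 _ φ.surjective
  have hc : Nat.card (L.map φ.toMonoidHom) = Nat.card L :=
    (Nat.card_congr (L.equivMapOfInjective φ.toMonoidHom φ.injective).toEquiv).symm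
  have hmem : (L ⊔ L.map φ.toMonoidHom) ∈
      {H : Subgroup N | H.Normal ∧ ¬ p ∣ Nat.card H} := by
    refine ⟨inferInstance, fun hd => ?_⟩
    have h1 := Subgroup.relIndex_mul_relIndex ⊥ L (L ⊔ L.map φ.toMonoidHom) bot_le le_sup_left
    rw [Subgroup.relIndex_bot_left, Subgroup.relIndex_bot_left,
      Subgroup.relIndex_sup_left] at h1
    rw [← h1, hp.dvd_mul] at hd
    rcases hd with hd | hd
    · exact hL.prop.2 hd
    · exact hL.prop.2 (hc ▸ hd.trans (Subgroup.relIndex_dvd_card _ _))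
  exact le_sup_right.trans (hL.le_of_ge hmem le_sup_left)

/-- Let `G` be a finite group with `O_{p'}(G) = 1` containing an element of order `p`
and in which all non-trivial `p`-elements are conjugate.  Suppose `N` is a minimal
normal subgroup of `G` that is not abelian.  Then `N` is a (non-abelian) simple group
of order divisible by `p`, `C_G(N) = 1` (so `G` embeds into `Aut(N)`, i.e. `G` is
almost simple with socle `N`), and `p` does not divide `|G/N|`. -/
theorem minimal_normal_nonabelian_of_two_classes
    (p : ℕ) (hp : p.Prime) (G : Type*) [Group G] [Finite G]
    (hop' : pPrimeCore p G = ⊥)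
    (hex : ∃ g : G, orderOf g = p)
    (hconj : ∀ x y : G, IsPElement p x → IsPElement p y → x ≠ 1 → y ≠ 1 → IsConj x y)
    (N : Subgroup G) (hNnormal : N.Normal) (hNbot : N ≠ ⊥)
    (hmin : ∀ M : Subgroup G, M.Normal → M ≤ N → M ≠ ⊥ → M = N)
    (hnab : ∃ a ∈ N, ∃ b ∈ N, a * b ≠ b * a) :
    IsSimpleGroup N ∧ p ∣ Nat.card N ∧
    Subgroup.centralizer (N : Set G) = ⊥ ∧
    ¬ p ∣ Nat.card (G ⧸ N) := by
  haveI := hNnormal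
  haveI : Fact p.Prime := ⟨hp⟩
  have hcore : ∀ H : Subgroup G, H.Normal → ¬ p ∣ Nat.card H → H = ⊥ := by
    intro H h1 h2
    rw [eq_bot_iff, ← hop']
    exact le_sSup ⟨h1, h2⟩
  have hpN : p ∣ Nat.card N := by
    by_contra h
    exact hNbot (hcore N hNnormal h)
  have hne : ∀ {x : G}, orderOf x = p → x ≠ 1 := by
    rintro x hx rfl
    rw [orderOf_one] at hx
    exact hp.one_lt.ne hx
  have hpe : ∀ {x : G}, orderOf x = p → IsPElement p x := fun hx => ⟨1, by simpa using hx⟩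
  obtain ⟨z, hz⟩ := exists_prime_orderOf_dvd_card' (G := N) p hpN
  have hz' : orderOf (z : G) = p := by simpa using hz
  have hall : ∀ x : G, IsPElement p x → x ∈ N := by
    intro x hx
    by_cases h1 : x = 1
    · exact h1 ▸ N.one_mem
    · obtain ⟨c, hc⟩ := isConj_iff.1 (hconj z x (hpe hz') hx (hne hz') h1)
      rw [← hc]
      exact hNnormal.conj_mem _ z.2 c
  have hZ : N ⊓ Subgroup.centralizer (N : Set G) = ⊥ := by
    by_contra h
    have h1 := hmin _ inferInstance inf_le_left h
    obtain ⟨a, ha, b, hb, hab⟩ := hnab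
    have hb' : b ∈ Subgroup.centralizer (N : Set G) := by
      rw [← h1] at hb
      exact hb.2
    exact hab (Subgroup.mem_centralizer_iff.1 hb' a ha)
  have hC : Subgroup.centralizer (N : Set G) = ⊥ := by
    apply hcore _ inferInstance
    intro h
    obtain ⟨c, hc⟩ := exists_prime_orderOf_dvd_card' p h
    have hc' : orderOf (c : G) = p := by simpa using hc
    have : (c : G) ∈ N ⊓ Subgroup.centralizer (N : Set G) := ⟨hall _ (hpe hc'), c.2⟩
    rw [hZ] at this
    exact hne hc' this
  have hidx : ¬ p ∣ Nat.card (G ⧸ N) := by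
    intro h
    obtain ⟨P⟩ := (inferInstance : Nonempty (Sylow p G))
    have hPN : (P : Subgroup G) ≤ N := by
      intro x hx
      obtain ⟨k, hk⟩ := (IsPGroup.iff_orderOf.1 P.2) ⟨x, hx⟩
      exact hall x ⟨k, by simpa using hk⟩
    have h2 : N.index ∣ (P : Subgroup G).index := Subgroup.index_dvd_of_le hPN
    exact P.not_dvd_index (h.trans h2)
  refine ⟨?_, hpN, hC, hidx⟩
  -- minimal normal subgroups of `N` are everything
  have key : ∀ M : Subgroup N, M.Normal → M ≠ ⊥ →
      (∀ K : Subgroup N, K.Normal → K ≤ M → K ≠ ⊥ → K = M) → M = ⊤ := by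
    intro M hM hMb hMmin
    by_contra hMt
    have hpM : p ∣ Nat.card M := by
      by_contra h
      obtain ⟨L, hLc, hML, hLp⟩ := exists_char_pprime p hp M hM h
      have h1 : (L.map N.subtype) = ⊥ := by
        apply hcore _ inferInstance
        rwa [Subgroup.card_map_of_injective N.subtype_injective]
      rw [Subgroup.map_eq_bot_iff_of_injective _ N.subtype_injective] at h1
      exact hMb (eq_bot_iff.2 (h1 ▸ hML))
    let C : G → Subgroup N := fun g => M.map (MulAut.conjNormal g : N ≃* N).toMonoidHom
    have hCn : ∀ g, (C g).Normal := fun g =>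
      Subgroup.Normal.map hM _ (MulAut.conjNormal g : N ≃* N).surjective
    have hCc : ∀ g, Nat.card (C g) = Nat.card M := fun g =>
      Subgroup.card_map_of_injective (MulAut.conjNormal g : N ≃* N).injective
    have hmemC : ∀ g, ∀ m ∈ M, (MulAut.conjNormal g m : N) ∈ C g := fun g m hm =>
      ⟨m, hm, rfl⟩
    have hdich : ∀ g, C g = M ∨ Disjoint M (C g) := by
      intro g
      haveI := hCn g
      by_cases h : M ⊓ C g = ⊥
      · exact Or.inr (disjoint_iff.2 h)
      · left
        have h1 : M ≤ C g := inf_eq_left.1 (hMmin _ inferInstance inf_le_left h)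
        exact (Subgroup.eq_of_le_of_card_ge h1 (hCc g).le).symm
    have hex1 : ∃ g, C g ≠ M := by
      by_contra! h
      have hn : (M.map N.subtype).Normal := by
        constructor
        rintro _ ⟨m, hm, rfl⟩ g
        refine ⟨MulAut.conjNormal g m, ?_, rfl⟩
        have := hmemC g m hm
        rwa [h g] at this
      have h2 : M.map N.subtype = N := by
        apply hmin _ hn (Subgroup.map_subtype_le M)
        rwa [Ne, Subgroup.map_eq_bot_iff_of_injective _ N.subtype_injective]
      apply hMt
      rw [eq_top_iff]
      rintro ⟨n, hn⟩ -
      have hn' := hn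
      rw [← h2] at hn'
      obtain ⟨m, hm, hmn⟩ := hn'
      have : m = ⟨n, hn⟩ := Subtype.ext hmn
      exact this ▸ hm
    obtain ⟨g, hg⟩ := hex1
    have hdg : Disjoint M (C g) := (hdich g).resolve_left hg
    obtain ⟨⟨x, hxM⟩, hx⟩ := exists_prime_orderOf_dvd_card' p hpM
    have hxN : orderOf x = p := by simpa using hx
    have hxG : orderOf (x : G) = p := by simpa using hxN
    have hcomm : ∀ k, Disjoint M (C k) → ∀ a ∈ M, ∀ b ∈ C k, Commute a b :=
      fun k hk a ha b hb => Subgroup.commute_of_normal_of_disjoint M (C k) hM (hCn k) hk a b ha hb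
    set y : N := MulAut.conjNormal g x with hy
    have hyC : y ∈ C g := hmemC g x hxM
    have hyN : orderOf y = p := by
      rw [hy, MulEquiv.orderOf_eq, hxN]
    have hxyp : (x * y) ^ p = 1 := by
      rw [(hcomm g hdg x hxM y hyC).mul_pow]
      nth_rewrite 1 [← hxN]
      rw [← hyN, pow_orderOf_eq_one, pow_orderOf_eq_one, one_mul]
    have hy1 : y ≠ 1 := by
      intro h
      rw [h, orderOf_one] at hyN
      exact hp.one_lt.ne hyN
    have hyM : y ∉ M := fun h => hy1 (Subgroup.disjoint_def.1 hdg h hyC)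
    have hxy1 : x * y ≠ 1 := by
      intro h
      apply hyM
      rw [← inv_eq_of_mul_eq_one_right h]
      exact M.inv_mem hxM
    have hxyo : orderOf ((x * y : N) : G) = p := by
      rw [Subgroup.orderOf_coe]
      exact orderOf_eq_prime hxyp hxy1
    obtain ⟨h, hh⟩ := isConj_iff.1
      (hconj x ((x * y : N) : G) (hpe hxG) (hpe hxyo) (hne hxG) (hne hxyo))
    have hxyC : x * y ∈ C h := by
      have h1 : (MulAut.conjNormal h x : N) = x * y := Subtype.ext hh
      rw [← h1]
      exact hmemC h x hxM
    have hdh : Disjoint M (C h) := by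
      refine (hdich h).resolve_left fun h1 => hyM ?_
      rw [h1] at hxyC
      exact (Subgroup.mul_mem_cancel_left M hxM).1 hxyC
    have hMx : ∀ m ∈ M, Commute m x := by
      intro m hm
      have h1 := (hcomm h hdh m hm _ hxyC).mul_right (hcomm g hdg m hm y hyC).inv_right
      simpa using h1
    have hCx : ∀ k, ∀ m ∈ C k, Commute m x := by
      intro k m hm
      rcases hdich k with h1 | h1
      · rw [h1] at hm
        exact hMx m hm
      · exact (hcomm k h1 x hxM m hm).symm
    have hcl : Subgroup.normalClosure (M.map N.subtype : Set G) = N := by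
      apply hmin _ inferInstance
      · exact Subgroup.normalClosure_le_normal (Subgroup.map_subtype_le M)
      · intro hb
        apply hMb
        rw [← Subgroup.map_eq_bot_iff_of_injective _ N.subtype_injective, eq_bot_iff, ← hb]
        exact Subgroup.subset_normalClosure
    have hle : Subgroup.normalClosure (M.map N.subtype : Set G) ≤
        Subgroup.centralizer {(x : G)} := by
      rw [Subgroup.normalClosure, Subgroup.closure_le]
      intro a ha
      obtain ⟨b, ⟨m, hm, rfl⟩, hb⟩ := Group.mem_conjugatesOfSet_iff.1 ha
      obtain ⟨k, rfl⟩ := isConj_iff.1 hb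
      have h1 := congrArg (Subtype.val) (hCx k _ (hmemC k m hm)).eq
      rw [SetLike.mem_coe, Subgroup.mem_centralizer_singleton_iff]
      simpa using h1
    rw [hcl] at hle
    have hxC : (x : G) ∈ Subgroup.centralizer (N : Set G) := by
      rw [Subgroup.mem_centralizer_iff]
      intro n hn
      exact Subgroup.mem_centralizer_singleton_iff.1 (hle hn)
    rw [hC] at hxC
    exact hne hxG hxC
  haveI : Nontrivial N := (Subgroup.nontrivial_iff_ne_bot N).2 hNbot
  refine { exists_pair_ne := exists_pair_ne N, eq_bot_or_eq_top_of_normal := ?_ }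
  intro H hH
  by_cases hHb : H = ⊥
  · exact Or.inl hHb
  right
  obtain ⟨M, hMH, hM⟩ := Set.Finite.exists_le_minimal
    (s := {K : Subgroup N | K.Normal ∧ K ≠ ⊥}) (Set.toFinite _) ⟨hH, hHb⟩
  have h1 := key M hM.prop.1 hM.prop.2
    (fun K hK hKM hKb => le_antisymm hKM (hM.le_of_le ⟨hK, hKb⟩ hKM))
  exact eq_top_iff.2 (h1 ▸ hMH)
end

section
/- Let p be a prime and let d = nk be a factorization of a positive integer d such that every prime divisor of n divides p^k − 1, and 4 divides p^k − 1 whenever 4 divides n. Then there exists an elementary abelian group D of order p^d and a group E of automorphisms of D acting regularly on D ∖ {1} (transitively with trivial point stabilizers) such that the number of conjugacy classes of E equals ∑_{e | n} ((p^{ek} − 1)/(ne)) · J_2(n/e). -/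
/-- Jordan's totient function `J₂(n) = n² ∏_{ℓ ∣ n, ℓ prime} (1 - 1/ℓ²)`. -/
def J2 (n : ℕ) : ℚ :=
  (n : ℚ) ^ 2 * ∏ ℓ ∈ n.primeFactors, (1 - 1 / (ℓ : ℚ) ^ 2)


/-- geometric sum `1 + q + ... + q^(i-1)` -/
def gB (q i : ℕ) : ℕ := ∑ x ∈ Finset.range i, q ^ x

theorem gB_add (q i j : ℕ) : gB q (i + j) = gB q i + q ^ i * gB q j := by
  simp [gB, Finset.sum_range_add, Finset.mul_sum, pow_add]

theorem gB_mul {q : ℕ} (hq : 1 ≤ q) (i : ℕ) : gB q i * (q - 1) = q ^ i - 1 :=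
  geom_sum_mul_of_one_le hq i

theorem gB_pos {q i : ℕ} (hq : 1 ≤ q) (hi : i ≠ 0) : 0 < gB q i := by
  obtain ⟨j, rfl⟩ := Nat.exists_eq_succ_of_ne_zero hi
  simp only [gB, Finset.sum_range_succ]
  positivity

theorem gB_modEq {q l : ℕ} (hq : 1 ≤ q) (h : l ∣ q - 1) (i : ℕ) : gB q i ≡ i [MOD l] := by
  have h1 : q ≡ 1 [MOD l] := ((Nat.modEq_iff_dvd' hq).2 h).symm
  induction i with
  | zero => rfl
  | succ i ih =>
    rw [gB, Finset.sum_range_succ]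
    exact ih.add (by simpa using h1.pow i)

theorem gB_val {q l m : ℕ} (hq : 1 < q) (hl : l.Prime) (h : l ∣ q - 1) (h2 : l = 2 → 4 ∣ q - 1)
    (hm : m ≠ 0) : padicValNat l (gB q m) = padicValNat l m := by
  have : Fact l.Prime := ⟨hl⟩
  have hlq : ¬ l ∣ q := fun h' => hl.one_lt.ne' (Nat.dvd_one.1 (by
    have := (Nat.dvd_sub_iff_right hq.le h').1 h
    exact this))
  have key : padicValNat l (q ^ m - 1) = padicValNat l (q - 1) + padicValNat l m := by
    rcases hl.eq_two_or_odd' with rfl | ho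
    · have := Int.two_pow_sub_pow' (x := q) (y := 1) m
        (by have := h2 rfl; zify [hq.le] at this; exact this) (by exact_mod_cast hlq)
      rw [← Nat.cast_inj (R := ℕ∞), Nat.cast_add, padicValNat_eq_emultiplicity,
        padicValNat_eq_emultiplicity, padicValNat_eq_emultiplicity]
      · rw [← Int.natCast_emultiplicity, ← Int.natCast_emultiplicity, ← Int.natCast_emultiplicity]
        rw [Nat.cast_sub (Nat.one_le_pow _ _ (by omega)), Nat.cast_sub hq.le]
        push_cast
        simpa using this
      · exact hm
      · omega
      · have := Nat.one_lt_pow hm hq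
        omega
    · simpa using padicValNat.pow_sub_pow (p := l) ho (x := q) (y := 1) hq h hlq hm
  rw [← gB_mul hq.le, padicValNat.mul (gB_pos hq.le hm).ne' (by omega)] at key
  omega

theorem dvd_gB {q n m : ℕ} (hq : 1 < q) (hdiv : ∀ ℓ : ℕ, ℓ.Prime → ℓ ∣ n → ℓ ∣ q - 1)
    (h4 : 4 ∣ n → 4 ∣ q - 1) : n ∣ gB q m ↔ n ∣ m := by
  rcases eq_or_ne m 0 with rfl | hm
  · simp [gB]
  have key : ∀ l k : ℕ, l.Prime → l ^ k ∣ n → (l ^ k ∣ gB q m ↔ l ^ k ∣ m) := by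
    intro l k hl hk
    have : Fact l.Prime := ⟨hl⟩
    rcases Nat.eq_zero_or_pos k with rfl | hk0
    · simp
    have hlq : l ∣ q - 1 := hdiv l hl ((dvd_pow_self l hk0.ne').trans hk)
    by_cases h2 : l = 2 → 4 ∣ q - 1
    · rw [padicValNat_dvd_iff_le (gB_pos hq.le hm).ne', padicValNat_dvd_iff_le hm,
        gB_val hq hl hlq h2 hm]
    · push Not at h2
      obtain ⟨rfl, h2⟩ := h2
      have : k = 1 := by
        by_contra hne
        exact h2 (h4 ((show 4 ∣ 2 ^ k from pow_dvd_pow 2 (show 2 ≤ k by omega)).trans hk))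
      subst this
      rw [pow_one]
      exact (gB_modEq hq.le hlq m).dvd_iff dvd_rfl
  rw [Nat.dvd_iff_prime_pow_dvd_dvd, Nat.dvd_iff_prime_pow_dvd_dvd]
  exact ⟨fun h l k hl hk => (key l k hl hk).1 (h l k hl hk),
    fun h l k hl hk => (key l k hl hk).2 (h l k hl hk)⟩

theorem gcd_main {q n e : ℕ} (hq : 1 < q) (hn : n ≠ 0)
    (hdiv : ∀ ℓ : ℕ, ℓ.Prime → ℓ ∣ n → ℓ ∣ q - 1)
    (h4 : 4 ∣ n → 4 ∣ q - 1) (he : e ∣ n) :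
    Nat.gcd (q ^ e - 1) ((q ^ n - 1) / n) * e = q ^ e - 1 := by
  obtain ⟨m, rfl⟩ := he
  have he0 : e ≠ 0 := by rintro rfl; simp at hn
  have hm0 : m ≠ 0 := by rintro rfl; simp at hn
  have hQ : 1 < q ^ e := Nat.one_lt_pow he0 hq
  have hqQ : q - 1 ∣ q ^ e - 1 := by rw [← gB_mul hq.le]; exact dvd_mul_left _ _
  obtain ⟨u, hu⟩ : m ∣ gB (q ^ e) m := (dvd_gB hQ
    (fun l hl h => (hdiv l hl (h.mul_left e)).trans hqQ)
    (fun h => (h4 (h.mul_left e)).trans hqQ)).2 dvd_rfl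
  obtain ⟨w, hw⟩ : e ∣ q ^ e - 1 := by
    rw [← gB_mul hq.le]
    exact ((dvd_gB hq (fun l hl h => hdiv l hl (h.mul_right m))
      (fun h => h4 (h.mul_right m))).2 dvd_rfl).mul_right _
  have h1 : q ^ (e * m) - 1 = (e * m) * (w * u) := by
    rw [pow_mul, ← gB_mul hQ.le, hu, hw]; ring
  rw [h1, Nat.mul_div_cancel_left _ (Nat.pos_of_ne_zero hn), hw]
  have hc : Nat.gcd e u = 1 := by
    by_contra hne
    obtain ⟨l, hl, hlg⟩ := Nat.exists_prime_and_dvd hne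
    have : Fact l.Prime := ⟨hl⟩
    have hle := hlg.trans (Nat.gcd_dvd_left _ _)
    have hlu := hlg.trans (Nat.gcd_dvd_right _ _)
    have hlq := hdiv l hl (hle.mul_right m)
    have := gB_val (m := m) hQ hl (hlq.trans hqQ) (by
      rintro rfl
      obtain ⟨f, rfl⟩ := hle
      have ho : Odd q := by
        rw [Nat.odd_iff]; omega
      have h8 := Nat.eight_dvd_sq_sub_one_of_odd ho
      have h9 : q ^ 2 - 1 ∣ q ^ (2 * f) - 1 := by
        rw [pow_mul, ← gB_mul (q := q ^ 2) (Nat.one_le_pow _ _ (by omega))]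
        exact dvd_mul_left _ _
      exact (by norm_num : 4 ∣ 8).trans (h8.trans h9)) hm0
    have hu0 : u ≠ 0 := by
      rintro rfl
      have := gB_pos hQ.le hm0
      omega
    rw [hu, padicValNat.mul hm0 hu0] at this
    have h3 := one_le_padicValNat_of_dvd hu0 hlu
    omega
  rw [mul_comm e w, Nat.gcd_mul_left, hc, mul_one]
theorem card_lin {N : ℕ} (hN : N ≠ 0) (a b : ℕ) :
    Nat.card {x : ZMod N × ZMod N // (a : ZMod N) * x.1 = b * x.2} =
      N * Nat.gcd (Nat.gcd a b) N := by
  have : NeZero N := ⟨hN⟩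
  let f : ZMod N × ZMod N →+ ZMod N :=
    (AddMonoidHom.mulLeft (a : ZMod N)).comp (AddMonoidHom.fst _ _) -
      (AddMonoidHom.mulLeft (b : ZMod N)).comp (AddMonoidHom.snd _ _)
  have hf : ∀ x, f x = a * x.1 - b * x.2 := fun x => rfl
  have hk : Nat.card {x : ZMod N × ZMod N // (a : ZMod N) * x.1 = b * x.2} = Nat.card f.ker := by
    apply Nat.card_congr
    refine Equiv.subtypeEquivRight fun x => ?_
    rw [AddMonoidHom.mem_ker, hf, sub_eq_zero]
  have hr : f.range = AddSubgroup.zmultiples ((Nat.gcd a b : ℕ) : ZMod N) := by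
    apply le_antisymm
    · rintro _ ⟨⟨x, y⟩, rfl⟩
      rw [hf, AddSubgroup.mem_zmultiples_iff]
      obtain ⟨a', ha⟩ := Nat.gcd_dvd_left a b
      obtain ⟨b', hb⟩ := Nat.gcd_dvd_right a b
      obtain ⟨x, rfl⟩ := ZMod.intCast_surjective x
      obtain ⟨y, rfl⟩ := ZMod.intCast_surjective y
      refine ⟨a' * x - b' * y, ?_⟩
      have ha' := congrArg (Nat.cast : ℕ → ZMod N) ha
      have hb' := congrArg (Nat.cast : ℕ → ZMod N) hb
      rw [Nat.cast_mul] at ha' hb'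
      rw [zsmul_eq_mul]
      push_cast
      linear_combination (-(x : ZMod N)) * ha' + (y : ZMod N) * hb'
    · rw [AddSubgroup.zmultiples_le]
      refine ⟨((Nat.gcdA a b : ℤ), -(Nat.gcdB a b : ℤ)), ?_⟩
      rw [hf]
      have := congrArg (Int.cast : ℤ → ZMod N) (Nat.gcd_eq_gcd_ab a b)
      push_cast at this ⊢
      linear_combination -this
  have h1 := f.ker.card_mul_index
  rw [AddSubgroup.index_ker, hr, Nat.card_zmultiples, ZMod.addOrderOf_coe _ hN, Nat.card_prod,
    Nat.card_zmod] at h1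
  rw [hk, Nat.gcd_comm _ N]
  have hg : N.gcd (a.gcd b) ∣ N := Nat.gcd_dvd_left _ _
  have hpos : 0 < N / N.gcd (a.gcd b) :=
    Nat.div_pos (Nat.le_of_dvd (by omega) hg) (Nat.gcd_pos_of_pos_left _ (by omega))
  apply Nat.eq_of_mul_eq_mul_right hpos
  rw [h1, mul_assoc, Nat.mul_div_cancel' hg]

theorem J2_zero : J2 0 = 0 := by simp [J2]

/-- `J2` as an arithmetic function -/
def J2A : ArithmeticFunction ℚ := ⟨J2, J2_zero⟩

theorem J2A_mult : J2A.IsMultiplicative := by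
  refine ⟨by simp [J2A, J2], ?_⟩
  intro m n h
  simp only [J2A, ArithmeticFunction.coe_mk, J2]
  rw [h.primeFactors_mul, Finset.prod_union h.disjoint_primeFactors]
  push_cast
  ring

theorem J2_prime_pow {l : ℕ} (hl : l.Prime) (i : ℕ) :
    J2 (l ^ (i + 1)) = (l : ℚ) ^ (2 * (i + 1)) - (l : ℚ) ^ (2 * i) := by
  have : (l : ℚ) ≠ 0 := by exact_mod_cast hl.ne_zero
  rw [J2, Nat.primeFactors_prime_pow (by omega) hl]
  simp
  field_simp
  ring

theorem sum_J2 (n : ℕ) : ∑ e ∈ n.divisors, J2 e = (n : ℚ) ^ 2 := by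
  have h : J2A * ((ArithmeticFunction.zeta : ArithmeticFunction ℕ) : ArithmeticFunction ℚ) =
      ((ArithmeticFunction.pow 2 : ArithmeticFunction ℕ) : ArithmeticFunction ℚ) := by
    rw [ArithmeticFunction.IsMultiplicative.eq_iff_eq_on_prime_powers _
      (J2A_mult.mul ArithmeticFunction.isMultiplicative_zeta.natCast) _
      ArithmeticFunction.isMultiplicative_pow.natCast]
    intro l i hl
    rw [ArithmeticFunction.coe_mul_zeta_apply, Nat.sum_divisors_prime_pow hl]
    simp only [J2A, ArithmeticFunction.coe_mk, ArithmeticFunction.natCoe_apply,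
      ArithmeticFunction.pow_apply]
    rw [Finset.sum_range_succ']
    simp only [J2_prime_pow hl]
    rw [Finset.sum_range_sub (fun i => (l : ℚ) ^ (2 * i))]
    simp [J2, pow_mul, mul_comm]
  have := congrArg (fun f => f n) h
  simp only [ArithmeticFunction.coe_mul_zeta_apply, ArithmeticFunction.natCoe_apply,
      ArithmeticFunction.pow_apply] at this
  simpa [J2A] using this

/-- pairs with gcd exactly `e` -/
def prs (n e : ℕ) : Finset (ℕ × ℕ) :=
  (Finset.range n ×ˢ Finset.range n).filter fun x => Nat.gcd (Nat.gcd x.1 x.2) n = e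

theorem card_prs_mul {e m : ℕ} (he : e ≠ 0) : (prs (e * m) e).card = (prs m 1).card := by
  symm
  apply Finset.card_bij (fun x _ => (e * x.1, e * x.2))
  · rintro ⟨a, b⟩ h
    simp only [prs, Finset.mem_filter, Finset.mem_product, Finset.mem_range] at h ⊢
    have := Nat.pos_of_ne_zero he
    refine ⟨⟨by gcongr; exact h.1.1, by gcongr; exact h.1.2⟩, ?_⟩
    rw [Nat.gcd_mul_left, Nat.gcd_mul_left, h.2, mul_one]
  · rintro ⟨a, b⟩ _ ⟨c, d⟩ _ h
    simpa [he] using h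
  · rintro ⟨a, b⟩ h
    simp only [prs, Finset.mem_filter, Finset.mem_product, Finset.mem_range] at h
    have hg : e ∣ Nat.gcd a b := by
      have := Nat.gcd_dvd_left (Nat.gcd a b) (e * m)
      rwa [h.2] at this
    obtain ⟨a, rfl⟩ := hg.trans (Nat.gcd_dvd_left _ _)
    obtain ⟨b, rfl⟩ := hg.trans (Nat.gcd_dvd_right _ _)
    refine ⟨(a, b), ?_, rfl⟩
    simp only [prs, Finset.mem_filter, Finset.mem_product, Finset.mem_range]
    refine ⟨⟨lt_of_mul_lt_mul_left h.1.1 (Nat.zero_le _),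
      lt_of_mul_lt_mul_left h.1.2 (Nat.zero_le _)⟩, ?_⟩
    have := h.2
    rw [Nat.gcd_mul_left, Nat.gcd_mul_left] at this
    exact Nat.eq_of_mul_eq_mul_left (Nat.pos_of_ne_zero he) (by simpa using this)

theorem sum_prs {n : ℕ} (hn : n ≠ 0) (f : ℕ → ℚ) :
    ∑ x ∈ Finset.range n ×ˢ Finset.range n, f (Nat.gcd (Nat.gcd x.1 x.2) n) =
      ∑ e ∈ n.divisors, (prs (n / e) 1).card * f e := by
  rw [← Finset.sum_fiberwise_of_maps_to (g := fun x => Nat.gcd (Nat.gcd x.1 x.2) n)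
    (t := n.divisors) (fun x _ => Nat.mem_divisors.2 ⟨Nat.gcd_dvd_right _ _, hn⟩)]
  apply Finset.sum_congr rfl
  intro e he
  obtain ⟨m, rfl⟩ := (Nat.mem_divisors.1 he).1
  have he0 : e ≠ 0 := by rintro rfl; simp at hn
  rw [Nat.mul_div_cancel_left _ (Nat.pos_of_ne_zero he0), ← card_prs_mul he0,
    Finset.sum_congr rfl (g := fun _ => f e)]
  · simp [prs]
  · intro x hx
    rw [(Finset.mem_filter.1 hx).2]

theorem card_prs_one (n : ℕ) (hn : n ≠ 0) : ((prs n 1).card : ℚ) = J2 n := by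
  induction n using Nat.strong_induction_on with
  | _ n ih =>
    have h1 := sum_prs hn (fun _ => 1)
    simp only [mul_one] at h1
    rw [Nat.sum_div_divisors n (fun e => ((prs e 1).card : ℚ))] at h1
    have h2 := sum_J2 n
    rw [← Nat.insert_self_properDivisors hn, Finset.sum_insert (by simp)] at h1 h2
    rw [Finset.sum_congr rfl (g := fun e => J2 e) (s₁ := n.properDivisors)] at h1
    · simp at h1
      linarith
    · intro e he
      rw [Nat.mem_properDivisors] at he
      exact ih e he.2 (by rintro rfl; simp at he; omega)

theorem gB_inj {q n i j : ℕ} (hq : 1 < q) (hdiv : ∀ ℓ : ℕ, ℓ.Prime → ℓ ∣ n → ℓ ∣ q - 1)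
    (h4 : 4 ∣ n → 4 ∣ q - 1) (h : gB q i ≡ gB q j [MOD n]) : i ≡ j [MOD n] := by
  wlog hij : i ≤ j generalizing i j
  · exact (this h.symm (by omega)).symm
  obtain ⟨m, rfl⟩ := Nat.exists_eq_add_of_le hij
  have hc : Nat.Coprime n (q ^ i) := by
    apply Nat.Coprime.pow_right
    by_contra hne
    obtain ⟨l, hl, hlg⟩ := Nat.exists_prime_and_dvd hne
    have h1 := hdiv l hl (hlg.trans (Nat.gcd_dvd_left _ _))
    have h2 := hlg.trans (Nat.gcd_dvd_right _ _)
    exact hl.one_lt.ne' (Nat.dvd_one.1 ((Nat.dvd_sub_iff_right hq.le h2).1 h1))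
  rw [gB_add, Nat.modEq_iff_dvd' (by omega), Nat.add_sub_cancel_left] at h
  have := (dvd_gB hq hdiv h4).1 (hc.dvd_of_dvd_mul_left h)
  rw [Nat.modEq_iff_dvd' (by omega), Nat.add_sub_cancel_left]
  exact this

theorem gB_surj {q n : ℕ} (hq : 1 < q) (hn : n ≠ 0)
    (hdiv : ∀ ℓ : ℕ, ℓ.Prime → ℓ ∣ n → ℓ ∣ q - 1)
    (h4 : 4 ∣ n → 4 ∣ q - 1) (s : ℕ) : ∃ i, s ≡ gB q i [MOD n] := by
  have : NeZero n := ⟨hn⟩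
  have hinj : Function.Injective (fun i : Fin n => ((gB q i : ℕ) : ZMod n)) := by
    intro i j h
    have := gB_inj hq hdiv h4 ((ZMod.natCast_eq_natCast_iff _ _ _).1 h)
    exact Fin.ext (Nat.ModEq.eq_of_lt_of_lt this i.2 j.2)
  have hb := (Fintype.bijective_iff_injective_and_card _).2 ⟨hinj, by simp⟩
  obtain ⟨i, hi⟩ := hb.2 (s : ZMod n)
  exact ⟨i, ((ZMod.natCast_eq_natCast_iff _ _ _).1 hi).symm⟩

section field
variable {F : Type} [Field F] [Finite F] (p k : ℕ) [Fact p.Prime] [CharP F p]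

/-- the semilinear map `x ↦ u x^(q^i)` with `q = p^k` -/
noncomputable def gA (u : Fˣ) (i : ℕ) : MulAut (Multiplicative F) :=
  AddEquiv.toMultiplicative
    ((iterateFrobeniusEquiv F p (k * i)).toAddEquiv.trans (AddAut.mulLeft u))

theorem gA_apply (u : Fˣ) (i : ℕ) (x : F) :
    gA p k u i (Multiplicative.ofAdd x) = Multiplicative.ofAdd ((u : F) * x ^ ((p ^ k) ^ i)) := by
  rw [← pow_mul]
  rfl

theorem gA_mul (u v : Fˣ) (i j : ℕ) :
    gA p k u i * gA p k v j = gA p k (u * v ^ ((p ^ k) ^ i)) (i + j) := by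
  ext x
  induction x using Multiplicative.rec with | _ x => ?_
  rw [MulAut.mul_apply, gA_apply, gA_apply, gA_apply]
  congr 1
  push_cast
  rw [mul_pow, ← pow_mul x, ← pow_add, add_comm j i, mul_assoc]

/-- the Dickson group -/
noncomputable def dE (w : Fˣ) (n : ℕ) : Subgroup (MulAut (Multiplicative F)) :=
  have hmul : ∀ {a b : MulAut (Multiplicative F)},
      (∃ s i, s ≡ gB (p ^ k) i [MOD n] ∧ a = gA p k (w ^ s) i) →
      (∃ s i, s ≡ gB (p ^ k) i [MOD n] ∧ b = gA p k (w ^ s) i) →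
      (∃ s i, s ≡ gB (p ^ k) i [MOD n] ∧ a * b = gA p k (w ^ s) i) := by
    rintro _ _ ⟨s, i, h, rfl⟩ ⟨t, j, h', rfl⟩
    refine ⟨s + t * (p ^ k) ^ i, i + j, ?_, ?_⟩
    · rw [gB_add, mul_comm]
      exact h.add (h'.mul_left _)
    · rw [gA_mul, ← pow_mul, ← pow_add]
  have hone : (∃ s i, s ≡ gB (p ^ k) i [MOD n] ∧ (1 : MulAut (Multiplicative F)) =
      gA p k (w ^ s) i) := by
    refine ⟨0, 0, by simp [gB]; rfl, ?_⟩
    ext x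
    induction x using Multiplicative.rec with | _ x => ?_
    rw [gA_apply]; simp
  let S : Submonoid (MulAut (Multiplicative F)) :=
    { carrier := {f | ∃ s i, s ≡ gB (p ^ k) i [MOD n] ∧ f = gA p k (w ^ s) i}
      mul_mem' := hmul
      one_mem' := hone }
  { S with
    inv_mem' := by
      intro f hf
      have h1 : f ∈ S := hf
      have h2 : f⁻¹ ∈ Submonoid.powers f := by
        rw [(isOfFinOrder_of_finite f).mem_powers_iff_mem_zpowers]
        exact inv_mem (Subgroup.mem_zpowers f)
      exact (Submonoid.powers_le.2 h1) h2 }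

theorem mem_dE {w : Fˣ} {n : ℕ} {f : MulAut (Multiplicative F)} :
    f ∈ dE p k w n ↔ ∃ s i, s ≡ gB (p ^ k) i [MOD n] ∧ f = gA p k (w ^ s) i := Iff.rfl

variable {p k} {n : ℕ} {w : Fˣ}
set_option linter.unusedSectionVars false

theorem frob_mod (hcard : Nat.card F = (p ^ k) ^ n) {i j : ℕ} (h : i ≡ j [MOD n]) (x : F) :
    x ^ ((p ^ k) ^ i) = x ^ ((p ^ k) ^ j) := by
  wlog hij : i ≤ j generalizing i j
  · exact (this h.symm (by omega)).symm
  obtain ⟨c, hc⟩ := (Nat.modEq_iff_dvd' hij).1 h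
  obtain rfl : j = n * c + i := by omega
  have := Fintype.ofFinite F
  rw [Nat.card_eq_fintype_card] at hcard
  rw [pow_add, pow_mul _ n, ← hcard, pow_mul, FiniteField.pow_card_pow]

theorem dE_inj (hq : 1 < p ^ k) (hdiv : ∀ ℓ : ℕ, ℓ.Prime → ℓ ∣ n → ℓ ∣ p ^ k - 1)
    (h4 : 4 ∣ n → 4 ∣ p ^ k - 1) (hcard : Nat.card F = (p ^ k) ^ n)
    (hw : n ∣ orderOf w) {f g : MulAut (Multiplicative F)}
    (hf : f ∈ dE p k w n) (hg : g ∈ dE p k w n)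
    (h : f (Multiplicative.ofAdd 1) = g (Multiplicative.ofAdd 1)) : f = g := by
  obtain ⟨s, i, hs, rfl⟩ := hf
  obtain ⟨t, j, ht, rfl⟩ := hg
  rw [gA_apply, gA_apply] at h
  have h1 : w ^ s = w ^ t := by
    apply Units.ext
    simpa using h
  have h2 := (pow_eq_pow_iff_modEq.1 h1).of_dvd hw
  have h3 : i ≡ j [MOD n] := gB_inj hq hdiv h4 (hs.symm.trans (h2.trans ht))
  ext x
  induction x using Multiplicative.rec with | _ x => ?_
  rw [gA_apply, gA_apply, h1, frob_mod hcard h3]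

theorem dE_trans (hq : 1 < p ^ k) (hn : n ≠ 0)
    (hdiv : ∀ ℓ : ℕ, ℓ.Prime → ℓ ∣ n → ℓ ∣ p ^ k - 1)
    (h4 : 4 ∣ n → 4 ∣ p ^ k - 1) (hw : ∀ x : Fˣ, x ∈ Subgroup.zpowers w)
    {y : Multiplicative F} (hy : y ≠ 1) :
    ∃ f ∈ dE p k w n, f (Multiplicative.ofAdd 1) = y := by
  induction y using Multiplicative.rec with | _ y => ?_
  have hy0 : y ≠ 0 := fun h => hy (by rw [h]; rfl)
  obtain ⟨s, hs⟩ : Units.mk0 y hy0 ∈ Submonoid.powers w := by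
    rw [(isOfFinOrder_of_finite w).mem_powers_iff_mem_zpowers]
    exact hw _
  obtain ⟨i, hi⟩ := gB_surj hq hn hdiv h4 s
  refine ⟨gA p k (w ^ s) i, ⟨s, i, hi, rfl⟩, ?_⟩
  rw [gA_apply, show w ^ s = _ from hs]
  simp

theorem card_dE (hq : 1 < p ^ k) (hn : n ≠ 0)
    (hdiv : ∀ ℓ : ℕ, ℓ.Prime → ℓ ∣ n → ℓ ∣ p ^ k - 1)
    (h4 : 4 ∣ n → 4 ∣ p ^ k - 1) (hcard : Nat.card F = (p ^ k) ^ n)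
    (hw : n ∣ orderOf w) (hw' : ∀ x : Fˣ, x ∈ Subgroup.zpowers w) :
    Nat.card (dE p k w n) = (p ^ k) ^ n - 1 := by
  rw [← hcard, ← Nat.card_units]
  have hne : ∀ f : MulAut (Multiplicative F),
      Multiplicative.toAdd (f (Multiplicative.ofAdd 1)) ≠ 0 := by
    intro f h
    have h1 : f (Multiplicative.ofAdd 1) = f 1 := (show f (Multiplicative.ofAdd 1) = 1 from h).trans (map_one f).symm
    have h2 := f.injective h1
    exact one_ne_zero (α := F) h2
  apply Nat.card_eq_of_bijective (fun f : dE p k w n => Units.mk0 _ (hne f.1))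
  constructor
  · intro f g h
    apply Subtype.ext
    apply dE_inj hq hdiv h4 hcard hw f.2 g.2
    exact congrArg Units.val h
  · intro y
    obtain ⟨f, hf, h⟩ := dE_trans (y := Multiplicative.ofAdd (y : F)) hq hn hdiv h4 hw'
      (fun h => y.ne_zero h)
    exact ⟨⟨f, hf⟩, Units.ext h⟩

/-- parametrisation of the Dickson group -/
noncomputable def dP (p k : ℕ) [Fact p.Prime] [CharP F p] (w : Fˣ) (n N : ℕ)
    (x : ZMod N × Fin n) : dE p k w n :=
  ⟨gA p k (w ^ (gB (p ^ k) x.2 + n * x.1.val)) x.2, _, _, by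
    simp [Nat.ModEq], rfl⟩

theorem dP_bij {N : ℕ} (hq : 1 < p ^ k) (hn : n ≠ 0) (hN : N ≠ 0)
    (hdiv : ∀ ℓ : ℕ, ℓ.Prime → ℓ ∣ n → ℓ ∣ p ^ k - 1)
    (h4 : 4 ∣ n → 4 ∣ p ^ k - 1) (hcard : Nat.card F = (p ^ k) ^ n)
    (hw : orderOf w = n * N) (hM : (p ^ k) ^ n - 1 = n * N)
    (hw' : ∀ x : Fˣ, x ∈ Subgroup.zpowers w) :
    Function.Bijective (dP p k w n N) := by
  have : NeZero N := ⟨hN⟩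
  rw [Nat.bijective_iff_injective_and_card]
  constructor
  · rintro ⟨a, i⟩ ⟨b, j⟩ h
    have h1 := congrArg (fun f : dE p k w n => f.1 (Multiplicative.ofAdd 1)) h
    simp only [dP, gA_apply] at h1
    have h2 : w ^ (gB (p ^ k) i + n * a.val) = w ^ (gB (p ^ k) j + n * b.val) := by
      apply Units.ext
      simpa using h1
    rw [pow_eq_pow_iff_modEq, hw] at h2
    have h3 : gB (p ^ k) i ≡ gB (p ^ k) j [MOD n] := by
      simpa [Nat.ModEq] using h2.of_dvd (dvd_mul_right n N)
    obtain rfl := Fin.ext (Nat.ModEq.eq_of_lt_of_lt (gB_inj hq hdiv h4 h3) i.2 j.2)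
    have h4 := (Nat.ModEq.add_left_cancel' _ h2).mul_left_cancel' hn
    have h5 := Nat.ModEq.eq_of_lt_of_lt h4 a.val_lt b.val_lt
    rw [ZMod.val_injective N h5]
  · rw [card_dE hq hn hdiv h4 hcard (hw ▸ dvd_mul_right _ _) hw', hM, Nat.card_prod]
    simp [mul_comm]

theorem dP_comm {N : ℕ} (hq : 1 < p ^ k) (hn : n ≠ 0) (hN : N ≠ 0)
    (hdiv : ∀ ℓ : ℕ, ℓ.Prime → ℓ ∣ n → ℓ ∣ p ^ k - 1)
    (h4 : 4 ∣ n → 4 ∣ p ^ k - 1) (hcard : Nat.card F = (p ^ k) ^ n)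
    (hw : orderOf w = n * N) (a b : ZMod N) (i j : Fin n) :
    Commute (dP p k w n N (a, i)) (dP p k w n N (b, j)) ↔
      (((p ^ k) ^ (j : ℕ) - 1 : ℕ) : ZMod N) * a = (((p ^ k) ^ (i : ℕ) - 1 : ℕ) : ZMod N) * b := by
  have : NeZero N := ⟨hN⟩
  have e1 : Commute (dP p k w n N (a, i)) (dP p k w n N (b, j)) ↔
      ((dP p k w n N (a, i) * dP p k w n N (b, j)).1 (Multiplicative.ofAdd 1) =
      (dP p k w n N (b, j) * dP p k w n N (a, i)).1 (Multiplicative.ofAdd 1)) := by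
    constructor
    · intro h
      rw [h.eq]
    · intro h
      exact Subtype.ext (dE_inj hq hdiv h4 hcard (hw ▸ dvd_mul_right _ _) (Subtype.prop _)
        (Subtype.prop _) h)
  rw [e1]
  obtain ⟨q, hqq⟩ : ∃ q, q = p ^ k := ⟨_, rfl⟩
  simp only [dP, Subgroup.coe_mul, gA_mul, gA_apply, one_pow, mul_one]
  simp only [← hqq] at *
  obtain ⟨A, rfl⟩ : ∃ A : ℕ, a = A := ⟨a.val, by simp⟩
  obtain ⟨B, rfl⟩ : ∃ B : ℕ, b = B := ⟨b.val, by simp⟩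
  have e2 : ∀ u v : Fˣ, (Multiplicative.ofAdd (u : F) = Multiplicative.ofAdd (v : F)) ↔ u = v :=
    fun u v => ⟨fun h => Units.ext h, fun h => by rw [h]⟩
  rw [e2, ← pow_mul, ← pow_mul, ← pow_add, ← pow_add, pow_eq_pow_iff_modEq, hw,
    ← Nat.cast_mul, ← Nat.cast_mul, ZMod.natCast_eq_natCast_iff]
  have hA : (((A : ZMod N).val : ℕ) : ZMod N) = A := by simp
  have hB : (((B : ZMod N).val : ℕ) : ZMod N) = B := by simp
  rw [ZMod.natCast_eq_natCast_iff] at hA hB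
  generalize (A : ZMod N).val = A' at *
  generalize (B : ZMod N).val = B' at *
  trans (q ^ (j : ℕ) - 1) * A' ≡ (q ^ (i : ℕ) - 1) * B' [MOD N]
  · have hi := gB_mul hq.le i
    have hj := gB_mul hq.le j
    have hi1 : 1 ≤ q ^ (i : ℕ) := Nat.one_le_pow _ _ (by omega)
    have hj1 : 1 ≤ q ^ (j : ℕ) := Nat.one_le_pow _ _ (by omega)
    rw [Nat.modEq_iff_dvd, Nat.modEq_iff_dvd]
    zify [hq.le, hi1, hj1] at hi hj ⊢
    have e3 : ((gB q j : ℤ) + n * B' + (gB q i + n * A') * q ^ (j : ℕ) -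
        (gB q i + n * A' + (gB q j + n * B') * q ^ (i : ℕ))) =
        - (n * ((q ^ (i : ℕ) - 1) * B' - (q ^ (j : ℕ) - 1) * A')) := by
      linear_combination (gB q j : ℤ) * hi - (gB q i : ℤ) * hj
    rw [e3, dvd_neg, mul_dvd_mul_iff_left (by exact_mod_cast hn)]
  · constructor
    · intro h
      exact (hA.symm.mul_left _).trans (h.trans (hB.mul_left _))
    · intro h
      exact (hA.mul_left _).trans (h.trans (hB.symm.mul_left _))

theorem card_comm_dE {N : ℕ} (hq : 1 < p ^ k) (hn : n ≠ 0) (hN : N ≠ 0)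
    (hdiv : ∀ ℓ : ℕ, ℓ.Prime → ℓ ∣ n → ℓ ∣ p ^ k - 1)
    (h4 : 4 ∣ n → 4 ∣ p ^ k - 1) (hcard : Nat.card F = (p ^ k) ^ n)
    (hw : orderOf w = n * N) (hM : (p ^ k) ^ n - 1 = n * N)
    (hw' : ∀ x : Fˣ, x ∈ Subgroup.zpowers w) :
    Nat.card {x : dE p k w n × dE p k w n // Commute x.1 x.2} =
      ∑ x ∈ Finset.range n ×ˢ Finset.range n,
        N * Nat.gcd ((p ^ k) ^ (Nat.gcd (Nat.gcd x.1 x.2) n) - 1) N := by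
  have : NeZero N := ⟨hN⟩
  let e := Equiv.ofBijective _ (dP_bij hq hn hN hdiv h4 hcard hw hM hw')
  let T : Fin n × Fin n → Type := fun x => {y : ZMod N × ZMod N //
    (((p ^ k) ^ (x.2 : ℕ) - 1 : ℕ) : ZMod N) * y.1 =
      (((p ^ k) ^ (x.1 : ℕ) - 1 : ℕ) : ZMod N) * y.2}
  have hT : Nat.card {x : dE p k w n × dE p k w n // Commute x.1 x.2} =
      Nat.card (Σ x, T x) := by
    symm
    apply Nat.card_eq_of_bijective (f := fun z =>
      (⟨(e (z.2.1.1, z.1.1), e (z.2.1.2, z.1.2)),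
        (dP_comm hq hn hN hdiv h4 hcard hw _ _ _ _).2 z.2.2⟩ :
        {x : dE p k w n × dE p k w n // Commute x.1 x.2}))
    constructor
    · rintro ⟨⟨i, j⟩, ⟨⟨a, b⟩, h⟩⟩ ⟨⟨i', j'⟩, ⟨⟨a', b'⟩, h'⟩⟩ hh
      have h1 := e.injective (congrArg (fun z => z.1.1) hh)
      have h2 := e.injective (congrArg (fun z => z.1.2) hh)
      simp only [Prod.mk.injEq] at h1 h2
      obtain ⟨rfl, rfl⟩ := h1
      obtain ⟨rfl, rfl⟩ := h2
      rfl
    · rintro ⟨⟨x, y⟩, h⟩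
      obtain ⟨⟨a, i⟩, rfl⟩ := e.surjective x
      obtain ⟨⟨b, j⟩, rfl⟩ := e.surjective y
      exact ⟨⟨(i, j), ⟨(a, b), (dP_comm hq hn hN hdiv h4 hcard hw _ _ _ _).1 h⟩⟩, rfl⟩
  rw [hT, Nat.card_sigma]
  simp only [T, card_lin hN]
  rw [Fintype.sum_prod_type, Finset.sum_product]
  rw [← Fin.sum_univ_eq_sum_range (fun i => ∑ j ∈ Finset.range n,
    N * Nat.gcd ((p ^ k) ^ (Nat.gcd (Nat.gcd i j) n) - 1) N)]
  refine Finset.sum_congr rfl fun i _ => ?_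
  rw [← Fin.sum_univ_eq_sum_range (fun j =>
    N * Nat.gcd ((p ^ k) ^ (Nat.gcd (Nat.gcd i j) n) - 1) N)]
  refine Finset.sum_congr rfl fun j _ => ?_
  rw [← Nat.pow_sub_one_gcd_pow_sub_one, ← Nat.pow_sub_one_gcd_pow_sub_one, hM,
    Nat.gcd_assoc _ (n * N), Nat.gcd_eq_right (dvd_mul_left N n), Nat.gcd_comm (_ - 1) (_ - 1)]

end field

theorem exists_regular_automorphism_group_of_dickson
    (p d n k : ℕ) (hp : p.Prime) (hd : 1 ≤ d) (hdnk : d = n * k)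
    (hdiv : ∀ ℓ : ℕ, ℓ.Prime → ℓ ∣ n → ℓ ∣ p ^ k - 1)
    (h4 : 4 ∣ n → 4 ∣ p ^ k - 1) :
    ∃ (D : Type) (_ : CommGroup D) (E : Subgroup (MulAut D)),
      Nat.card D = p ^ d ∧ (∀ x : D, x ^ p = 1) ∧
      (∀ x y : D, x ≠ 1 → y ≠ 1 → ∃ φ ∈ E, φ x = y) ∧
      (∀ φ ∈ E, φ ≠ 1 → ∀ x : D, φ x = x → x = 1) ∧
      (Nat.card (ConjClasses E) : ℚ) =
        ∑ e ∈ n.divisors, ((p : ℚ) ^ (e * k) - 1) / ((n : ℚ) * (e : ℚ)) * J2 (n / e) := by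
  have : Fact p.Prime := ⟨hp⟩
  have hn : n ≠ 0 := by rintro rfl; omega
  have hk : k ≠ 0 := by rintro rfl; omega
  have hq : 1 < p ^ k := Nat.one_lt_pow hk hp.one_lt
  let F := GaloisField p d
  have hFd : Nat.card F = p ^ d := GaloisField.card p d (by omega)
  have : Finite F := Nat.finite_of_card_ne_zero (by rw [hFd]; exact pow_ne_zero _ hp.ne_zero)
  have hcard : Nat.card F = (p ^ k) ^ n := by rw [hFd, hdnk, mul_comm, pow_mul]
  obtain ⟨w, hw'⟩ := IsCyclic.exists_generator (α := Fˣ)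
  have hord : orderOf w = (p ^ k) ^ n - 1 := by
    rw [orderOf_eq_card_of_forall_mem_zpowers hw', Nat.card_units, hcard]
  obtain ⟨N, hM⟩ : n ∣ (p ^ k) ^ n - 1 := by
    rw [← gB_mul hq.le]
    exact ((dvd_gB hq hdiv h4).2 dvd_rfl).mul_right _
  have hN : N ≠ 0 := by
    rintro rfl
    have := Nat.one_lt_pow hn hq
    omega
  have hw : orderOf w = n * N := hord.trans hM
  have hdw : n ∣ orderOf w := hw ▸ dvd_mul_right _ _
  refine ⟨Multiplicative F, inferInstance, dE p k w n, hFd, ?_, ?_, ?_, ?_⟩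
  · intro x
    induction x using Multiplicative.rec with | _ x => ?_
    rw [← ofAdd_nsmul, nsmul_eq_mul, CharP.cast_eq_zero F p, zero_mul]
    rfl
  · intro x y hx hy
    obtain ⟨f, hf, rfl⟩ := dE_trans hq hn hdiv h4 hw' hx
    obtain ⟨g, hg, rfl⟩ := dE_trans hq hn hdiv h4 hw' hy
    exact ⟨g * f⁻¹, mul_mem hg (inv_mem hf), by simp⟩
  · intro f hf hne x hx
    by_contra hx1
    obtain ⟨g, hg, rfl⟩ := dE_trans hq hn hdiv h4 hw' hx1
    have := dE_inj hq hdiv h4 hcard hdw (mul_mem hf hg) hg (by simpa using hx)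
    exact hne (by simpa using this)
  · have h1 := card_comm_eq_card_conjClasses_mul_card (dE p k w n)
    rw [card_comm_dE hq hn hN hdiv h4 hcard hw hM hw', card_dE hq hn hdiv h4 hcard hdw hw', hM] at h1
    have h2 := congrArg (Nat.cast : ℕ → ℚ) h1
    rw [Nat.cast_sum, sum_prs hn (fun e => ((N * Nat.gcd ((p ^ k) ^ e - 1) N : ℕ) : ℚ))] at h2
    have hnq : (n : ℚ) ≠ 0 := by exact_mod_cast hn
    have hNq : (N : ℚ) ≠ 0 := by exact_mod_cast hN
    push_cast at h2
    have h3 : (Nat.card (ConjClasses (dE p k w n)) : ℚ) = _ / (n * N) :=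
      (eq_div_iff (mul_ne_zero hnq hNq)).2 h2.symm
    rw [h3, Finset.sum_div]
    refine Finset.sum_congr rfl fun e he => ?_
    have hen := (Nat.mem_divisors.1 he).1
    have he0 : e ≠ 0 := by rintro rfl; simp at he
    have heq : (e : ℚ) ≠ 0 := by exact_mod_cast he0
    have hne0 : n / e ≠ 0 := (Nat.div_pos (Nat.le_of_dvd (by omega) hen) (by omega)).ne'
    have h5 := gcd_main hq hn hdiv h4 hen
    rw [hM, Nat.mul_div_cancel_left _ (by omega)] at h5
    have h6 := congrArg (Nat.cast : ℕ → ℚ) h5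
    rw [Nat.cast_sub (Nat.one_le_pow _ _ (by omega))] at h6
    push_cast at h6
    rw [card_prs_one _ hne0, mul_comm e k, pow_mul, ← h6]
    field_simp
end
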